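/- There exists a constant C > 0 such that the following holds with ε = 0.0028. For all natural numbers n and d, for every injective tuple of vectors v_1, …, v_n ∈ 𝔽₂^d with V = {v_1, …, v_n}, and for all finite sets N_1, …, N_n ⊆ V satisfying condition (i) (for all i ∈ [n], v_i + N_i = N_i) and condition (ii) (for all i ∈ [n] and all j < i, v_j ∉ span_{𝔽₂}(N_i + N_i)), one has Σ_{i=1}^n |N_i| ≤ C · n^{2 − ε}. -/

import Mathlib

open Pointwise

/-- The subsets of `Fin m` with at most `k` elements. -/
def smallSubsets (m k : ℕ) : Finset (Finset (Fin m)) := {s | s.card ≤ k}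

lemma mem_smallSubsets {m k : ℕ} {s : Finset (Fin m)} : s ∈ smallSubsets m k ↔ s.card ≤ k := by
  simp [smallSubsets]

/-- The multilinear polynomial with coefficients `c`, as a function on `𝔽₂^m`. -/
def multilinearEval {m : ℕ} (c : Finset (Fin m) → ZMod 2) (x : Fin m → ZMod 2) : ZMod 2 :=
  ∑ s, c s * ∏ i ∈ s, x i

lemma exists_multilinearEval_ne_zero {m : ℕ} {c : Finset (Fin m) → ZMod 2} (hc : c ≠ 0) :
    ∃ x, multilinearEval c x ≠ 0 := by
  classical
  obtain ⟨s₁, hs₁⟩ := Function.ne_iff.1 hc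
  obtain ⟨s, hs, hmin⟩ := Finset.exists_min_image ({s | c s ≠ 0} : Finset (Finset (Fin m)))
    Finset.card ⟨s₁, by simpa using hs₁⟩
  simp only [Finset.mem_filter, Finset.mem_univ, true_and] at hs hmin
  refine ⟨fun i => if i ∈ s then 1 else 0, ?_⟩
  rw [multilinearEval, Finset.sum_eq_single s]
  · rw [Finset.prod_eq_one (fun i hi => if_pos hi)]
    simpa using hs
  · intro t _ hts
    by_cases hsub : t ⊆ s
    · by_contra h
      exact hts (Finset.eq_of_subset_of_card_le hsub (hmin t (left_ne_zero_of_mul h)))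
    · obtain ⟨i, hit, his⟩ := Finset.not_subset.1 hsub
      rw [Finset.prod_eq_zero hit (if_neg his), mul_zero]
  · simp

lemma card_le_card_smallSubsets_add {m k : ℕ} (hk : m ≤ 3 * k + 2) :
    2 ^ m ≤ (smallSubsets m (2 * k + 1)).card + (smallSubsets m k).card := by
  classical
  have h : (smallSubsets m (2 * k + 1))ᶜ.card ≤ (smallSubsets m k).card := by
    refine Finset.card_le_card_of_injOn compl ?_ compl_injective.injOn
    intro s hs
    have hs' : ¬ s.card ≤ 2 * k + 1 := by simpa [mem_smallSubsets] using hs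
    have h2 := Finset.card_compl s
    rw [Fintype.card_fin] at h2
    refine mem_smallSubsets.2 ?_
    omega
  have h2 := Finset.card_add_card_compl (smallSubsets m (2 * k + 1))
  simp only [Fintype.card_finset, Fintype.card_fin] at h2
  omega

/-- There is a nonzero polynomial of degree at most `2 * k + 1` supported on any large enough set. -/
lemma exists_multilinear_supported {m k : ℕ} (hk : m ≤ 3 * k + 2)
    (S : Finset (Fin m → ZMod 2)) (hS : (smallSubsets m k).card < S.card) :
    ∃ c : Finset (Fin m) → ZMod 2, (∀ s, c s ≠ 0 → s.card ≤ 2 * k + 1) ∧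
      (∃ x, multilinearEval c x ≠ 0) ∧ ∀ x, x ∉ S → multilinearEval c x = 0 := by
  classical
  let M : Matrix {x // x ∉ S} {s // s ∈ smallSubsets m (2 * k + 1)} (ZMod 2) :=
    Matrix.of fun x s => ∏ i ∈ s.1, x.1 i
  have hker : LinearMap.ker M.mulVecLin ≠ ⊥ := by
    apply LinearMap.ker_ne_bot_of_finrank_lt
    have h1 := card_le_card_smallSubsets_add hk
    have h2 : Fintype.card {x // x ∉ S} = 2 ^ m - S.card := by
      rw [Fintype.card_subtype_compl]
      simp [ZMod.card]
    simp only [Module.finrank_fintype_fun_eq_card, h2, Fintype.card_coe]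
    have h3 : S.card ≤ 2 ^ m := by simpa [ZMod.card] using S.card_le_univ
    omega
  obtain ⟨c, hc, hc0⟩ := (Submodule.ne_bot_iff _).1 hker
  let c' : Finset (Fin m) → ZMod 2 :=
    fun s => if h : s ∈ smallSubsets m (2 * k + 1) then c ⟨s, h⟩ else 0
  refine ⟨c', fun s hs => ?_, exists_multilinearEval_ne_zero fun h => hc0 ?_, fun x hx => ?_⟩
  · by_contra h
    exact hs (dif_neg fun h' => h (mem_smallSubsets.1 h'))
  · ext s
    have := congrFun h s.1
    simpa [c', s.2] using this
  · have h := congrFun (LinearMap.mem_ker.1 hc) ⟨x, hx⟩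
    simp only [Matrix.mulVecLin_apply, Matrix.mulVec, dotProduct, Matrix.of_apply, M,
      Pi.zero_apply] at h
    rw [multilinearEval, ← h, ← Finset.sum_subset (Finset.subset_univ (smallSubsets m (2 * k + 1))),
      ← Finset.sum_coe_sort]
    · exact Finset.sum_congr rfl fun s _ => by
        rw [mul_comm, show c' s.1 = c s from dif_pos s.2]
    · intro s _ hs
      simp [c', hs]

lemma multilinearEval_add {m k : ℕ} {c : Finset (Fin m) → ZMod 2}
    (hc : ∀ s, c s ≠ 0 → s.card ≤ 2 * k + 1) (x y : Fin m → ZMod 2) :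
    multilinearEval c (x + y) =
      (∑ t ∈ smallSubsets m k, (∏ i ∈ t, x i) *
        ∑ s, if t ⊆ s then c s * ∏ i ∈ s \ t, y i else 0) +
      ∑ t ∈ smallSubsets m k,
        (∑ s, if t ⊆ s ∧ k < (s \ t).card then c s * ∏ i ∈ s \ t, x i else 0) *
          ∏ i ∈ t, y i := by
  classical
  have h1 : ∀ s, c s * ∏ i ∈ s, (x + y) i =
      (∑ t ∈ smallSubsets m k, if t ⊆ s then c s * ((∏ i ∈ t, x i) * ∏ i ∈ s \ t, y i) else 0) +
      ∑ t ∈ smallSubsets m k, if t ⊆ s ∧ k < (s \ t).card then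
        c s * ((∏ i ∈ s \ t, x i) * ∏ i ∈ t, y i) else 0 := by
    intro s
    simp only [Pi.add_apply, Finset.prod_add, Finset.mul_sum]
    rw [← Finset.sum_filter_add_sum_filter_not s.powerset (fun t => t.card ≤ k)]
    congr 1
    · rw [← Finset.sum_filter]
      refine Finset.sum_congr ?_ fun _ _ => rfl
      ext t
      simp [mem_smallSubsets, and_comm]
    · rw [← Finset.sum_filter]
      by_cases hs : c s = 0
      · simp [hs]
      have hs := hc s hs
      refine Finset.sum_nbij' (fun t => s \ t) (fun t => s \ t) ?_ ?_ ?_ ?_ ?_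
      · intro t ht
        simp only [Finset.mem_filter, Finset.mem_powerset, mem_smallSubsets] at ht ⊢
        rw [Finset.sdiff_sdiff_eq_self ht.1]
        have := Finset.card_sdiff_add_card_eq_card ht.1
        exact ⟨by omega, Finset.sdiff_subset, by omega⟩
      · intro t ht
        simp only [Finset.mem_filter, Finset.mem_powerset, mem_smallSubsets] at ht ⊢
        exact ⟨Finset.sdiff_subset, by omega⟩
      · intro t ht
        simp only [Finset.mem_filter, Finset.mem_powerset] at ht
        exact Finset.sdiff_sdiff_eq_self ht.1
      · intro t ht
        simp only [Finset.mem_filter] at ht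
        exact Finset.sdiff_sdiff_eq_self ht.2.1
      · intro t ht
        simp only [Finset.mem_filter, Finset.mem_powerset] at ht
        rw [Finset.sdiff_sdiff_eq_self ht.1]
  rw [multilinearEval, Finset.sum_congr rfl fun s _ => h1 s, Finset.sum_add_distrib,
    Finset.sum_comm, Finset.sum_comm (s := Finset.univ) (t := smallSubsets m k)]
  congr 1
  · refine Finset.sum_congr rfl fun t _ => ?_
    rw [Finset.mul_sum]
    refine Finset.sum_congr rfl fun s _ => ?_
    split_ifs
    · ring
    · simp
  · refine Finset.sum_congr rfl fun t _ => ?_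
    rw [Finset.sum_mul]
    refine Finset.sum_congr rfl fun s _ => ?_
    split_ifs
    · ring
    · simp

/-- The Croot-Lev-Pach rank bound. -/
lemma card_le_of_multilinearEval_diagonal {m k : ℕ} {c : Finset (Fin m) → ZMod 2}
    (hc : ∀ s, c s ≠ 0 → s.card ≤ 2 * k + 1) {ι : Type*} [Fintype ι] [DecidableEq ι]
    (p q : ι → Fin m → ZMod 2)
    (hpq : ∀ a b, multilinearEval c (p a + q b) = if a = b then 1 else 0) :
    Fintype.card ι ≤ 2 * (smallSubsets m k).card := by
  classical
  let P₁ : Matrix ι (smallSubsets m k) (ZMod 2) := Matrix.of fun a t => ∏ i ∈ t.1, p a i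
  let Q₁ : Matrix (smallSubsets m k) ι (ZMod 2) := Matrix.of fun t b =>
    ∑ s, if t.1 ⊆ s then c s * ∏ i ∈ s \ t.1, q b i else 0
  let P₂ : Matrix ι (smallSubsets m k) (ZMod 2) := Matrix.of fun a t =>
    ∑ s, if t.1 ⊆ s ∧ k < (s \ t.1).card then c s * ∏ i ∈ s \ t.1, p a i else 0
  let Q₂ : Matrix (smallSubsets m k) ι (ZMod 2) := Matrix.of fun t b => ∏ i ∈ t.1, q b i
  have h : (1 : Matrix ι ι (ZMod 2)) = P₁ * Q₁ + P₂ * Q₂ := by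
    ext a b
    rw [Matrix.one_apply, ← hpq, multilinearEval_add hc, ← Finset.sum_coe_sort,
      ← Finset.sum_coe_sort (smallSubsets m k)]
    rfl
  rw [← Matrix.fromCols_mul_fromRows] at h
  calc Fintype.card ι = (1 : Matrix ι ι (ZMod 2)).rank := Matrix.rank_one.symm
    _ ≤ (Matrix.fromCols P₁ P₂).rank := h ▸ Matrix.rank_mul_le_left _ _
    _ ≤ _ := Matrix.rank_le_card_width _
    _ = 2 * (smallSubsets m k).card := by simp [two_mul]

/-- The binomial tail bound. -/
lemma card_smallSubsets_pow_le (m : ℕ) :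
    ((smallSubsets m (m / 3)).card : ℝ) ^ 3 ≤ (27 / 4) ^ m := by
  have h1 : ((smallSubsets m (m / 3)).card : ℝ) ≤ 2 ^ (m / 3) * (3 / 2) ^ m := by
    have h2 : (∑ s : Finset (Fin m), (1 / 2 : ℝ) ^ s.card) = (3 / 2) ^ m := by
      have := Fintype.sum_pow_mul_eq_add_pow (Fin m) (1 / 2 : ℝ) 1
      simp only [one_pow, mul_one, Fintype.card_fin] at this
      rw [this]; norm_num
    rw [← h2, Finset.mul_sum, Finset.card_eq_sum_ones, Nat.cast_sum]
    refine (Finset.sum_le_sum fun s hs => ?_).trans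
      (Finset.sum_le_sum_of_subset_of_nonneg (Finset.subset_univ (smallSubsets m (m / 3)))
        fun _ _ _ => by positivity)
    rw [Nat.cast_one, one_div, inv_pow, ← div_eq_mul_inv, one_le_div (by positivity)]
    exact pow_le_pow_right₀ one_le_two (mem_smallSubsets.1 hs)
  calc ((smallSubsets m (m / 3)).card : ℝ) ^ 3 ≤ (2 ^ (m / 3) * (3 / 2) ^ m) ^ 3 := by gcongr
    _ = 2 ^ (m / 3 * 3) * ((3 / 2) ^ 3) ^ m := by
      rw [mul_pow, ← pow_mul, ← pow_mul, ← pow_mul, mul_comm m 3]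
    _ ≤ 2 ^ m * ((3 / 2) ^ 3) ^ m := by
      gcongr
      · norm_num
      · exact Nat.div_mul_le_self m 3
    _ = (27 / 4) ^ m := by rw [← mul_pow]; norm_num

/-- A maximal subspace avoiding the nonzero elements of `Q` has small index. -/
lemma exists_linearMap_ne_zero_on {E : Type*} [AddCommGroup E] [Module (ZMod 2) E] [Finite E]
    (Q : Finset E) (hQ : 0 ∈ Q) :
    ∃ (m : ℕ) (φ : E →ₗ[ZMod 2] (Fin m → ZMod 2)), 2 ^ m ≤ Q.card ∧ ∀ q ∈ Q, φ q = 0 → q = 0 := by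
  classical
  have hfin : Finite (Submodule (ZMod 2) E) :=
    Finite.of_injective (fun K => (K : Set E)) SetLike.coe_injective
  obtain ⟨K, hK⟩ := Set.Finite.exists_maximal
    (s := {K : Submodule (ZMod 2) E | ∀ q ∈ Q, q ∈ K → q = 0}) (Set.toFinite _)
    ⟨⊥, fun q _ hq => by simpa using hq⟩
  have hKQ : ∀ q ∈ Q, q ∈ K → q = 0 := hK.prop
  have hsurj : ∀ u : E ⧸ K, u ∈ Q.image K.mkQ := by
    intro u
    obtain ⟨u, rfl⟩ := K.mkQ_surjective u
    by_cases hu : u ∈ K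
    · refine Finset.mem_image.2 ⟨0, hQ, ?_⟩
      rw [map_zero]
      exact ((Submodule.Quotient.mk_eq_zero K).2 hu).symm
    · have hlt : ¬ ∀ q ∈ Q, q ∈ K ⊔ Submodule.span (ZMod 2) {u} → q = 0 := by
        intro h
        have := hK.le_of_ge (y := K ⊔ Submodule.span (ZMod 2) {u}) h le_sup_left
        exact hu (this (Submodule.mem_sup_right (Submodule.mem_span_singleton_self u)))
      push Not at hlt
      obtain ⟨q, hqQ, hq, hq0⟩ := hlt
      obtain ⟨w, hw, z, hz, rfl⟩ := Submodule.mem_sup.1 hq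
      obtain ⟨a, rfl⟩ := Submodule.mem_span_singleton.1 hz
      refine Finset.mem_image.2 ⟨_, hqQ, ?_⟩
      have ha : a = 0 ∨ a = 1 := (by decide : ∀ a : ZMod 2, a = 0 ∨ a = 1) a
      rcases ha with rfl | rfl
      · refine absurd (hKQ _ hqQ ?_) hq0
        simpa using hw
      · rw [map_add, one_smul]
        simpa using hw
  have : Finite (E ⧸ K) := Finite.of_surjective _ K.mkQ_surjective
  have : Module.Finite (ZMod 2) (E ⧸ K) := Module.Finite.of_finite
  let e := LinearEquiv.ofFinrankEq (R := ZMod 2) (E ⧸ K)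
    (Fin (Module.finrank (ZMod 2) (E ⧸ K)) → ZMod 2) (by simp)
  refine ⟨_, e.toLinearMap ∘ₗ K.mkQ, ?_, ?_⟩
  · have h1 : Nat.card (E ⧸ K) = 2 ^ Module.finrank (ZMod 2) (E ⧸ K) := by
      rw [Module.natCard_eq_pow_finrank (K := ZMod 2)]
      simp
    rw [← h1, ← Nat.card_eq_fintype_card (α := Q) |>.trans (Fintype.card_coe Q)]
    refine Nat.card_le_card_of_surjective (fun q : Q => K.mkQ q.1) fun u => ?_
    obtain ⟨q, hq, rfl⟩ := Finset.mem_image.1 (hsurj u)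
    exact ⟨⟨q, hq⟩, rfl⟩
  · intro q hq h
    refine hKQ q hq ?_
    have h' : e (K.mkQ q) = 0 := h
    rw [LinearEquiv.map_eq_zero_iff] at h'
    exact (Submodule.Quotient.mk_eq_zero K).1 h'

/-- A Plünnecke-Ruzsa inequality for sums of two copies of each of two sets. -/
lemma card_add_add_add_le {G : Type*} [AddCommGroup G] [DecidableEq G] (A S : Finset G)
    (hA : A.Nonempty) (hS : S.Nonempty) :
    ((A + A + (S + S)).card : ℝ) * (S.card ^ 2 * A.card ^ 2) ≤ ((A + S).card : ℝ) ^ 5 := by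
  obtain ⟨X, hX, hmin⟩ := Finset.exists_min_image (A.powerset.erase ∅)
    (fun X => ((X + S).card : ℝ) / X.card)
    ⟨A, Finset.mem_erase_of_ne_of_mem hA.ne_empty (Finset.mem_powerset_self _)⟩
  obtain ⟨hX0, hXA⟩ := Finset.mem_erase.1 hX
  rw [Finset.mem_powerset] at hXA
  have hXne : X.Nonempty := Finset.nonempty_iff_ne_empty.2 hX0
  have hmin' : ∀ A' ⊆ A, ((X + S).card : ℝ) * A'.card ≤ (A' + S).card * X.card := by
    intro A' hA'
    rcases A'.eq_empty_or_nonempty with rfl | hne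
    · simp
    have := hmin A' (Finset.mem_erase_of_ne_of_mem hne.ne_empty (Finset.mem_powerset.2 hA'))
    rwa [div_le_div_iff₀ (by exact_mod_cast hXne.card_pos) (by exact_mod_cast hne.card_pos)] at this
  have hXS := hmin' A subset_rfl
  have hpet : ((S + X + S).card : ℝ) * X.card ≤ (X + S).card * (S + X).card := by
    exact_mod_cast Finset.pluennecke_petridis_inequality_add S
      fun A' hA' => by exact_mod_cast hmin' A' (hA'.trans hXA)
  have htri : ((A + A + (S + S)).card : ℝ) * X.card ≤ (A + A + X).card * (X + (S + S)).card := by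
    exact_mod_cast Finset.ruzsa_triangle_inequality_add_add_add (A + A) X (S + S)
  have hpr : ((3 • A).card : ℝ) ≤ ((S + A).card / S.card : ℝ) ^ 3 * S.card := by
    have := Finset.pluennecke_ruzsa_inequality_nsmul_add hS A 3
    simpa using (NNRat.cast_le (K := ℝ)).2 this
  have hsub : ((A + A + X).card : ℝ) ≤ (3 • A).card := by
    have : A + A + X ⊆ 3 • A := by
      rw [show 3 • A = A + A + A by rw [succ_nsmul, two_nsmul]]
      exact Finset.add_subset_add_left hXA
    exact_mod_cast Finset.card_le_card this
  rw [add_comm S X] at hpet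
  rw [add_assoc] at hpet
  rw [add_comm S A] at hpr
  have hx : (0 : ℝ) < X.card := by exact_mod_cast hXne.card_pos
  have ha : (0 : ℝ) < A.card := by exact_mod_cast hA.card_pos
  have hs : (0 : ℝ) < S.card := by exact_mod_cast hS.card_pos
  generalize ((A + A + (S + S)).card : ℝ) = q at *
  generalize ((A + A + X).card : ℝ) = t at *
  generalize ((3 • A).card : ℝ) = t' at *
  have hr : (0 : ℝ) ≤ ((X + (S + S)).card : ℝ) := by positivity
  have hp : (0 : ℝ) ≤ ((A + S).card : ℝ) := by positivity
  have hu : (0 : ℝ) ≤ ((X + S).card : ℝ) := by positivity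
  generalize ((X + (S + S)).card : ℝ) = r at *
  generalize ((A + S).card : ℝ) = p at *
  generalize ((X + S).card : ℝ) = u at *
  generalize (X.card : ℝ) = x at *
  generalize (A.card : ℝ) = a at *
  generalize (S.card : ℝ) = s at *
  have h1 : t * s ^ 2 ≤ p ^ 3 := by
    calc t * s ^ 2 ≤ ((p / s) ^ 3 * s) * s ^ 2 := by gcongr; linarith
      _ = p ^ 3 := by field_simp
  have h2 : r * a ^ 2 ≤ p ^ 2 * x := by
    refine le_of_mul_le_mul_right ?_ hx
    calc r * a ^ 2 * x = (r * x) * a ^ 2 := by ring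
      _ ≤ (u * u) * a ^ 2 := by gcongr
      _ = (u * a) ^ 2 := by ring
      _ ≤ (p * x) ^ 2 := by gcongr
      _ = p ^ 2 * x * x := by ring
  refine le_of_mul_le_mul_right ?_ hx
  calc q * (s ^ 2 * a ^ 2) * x = (q * x) * (s ^ 2 * a ^ 2) := by ring
    _ ≤ (t * r) * (s ^ 2 * a ^ 2) := by gcongr
    _ = (t * s ^ 2) * (r * a ^ 2) := by ring
    _ ≤ p ^ 3 * (p ^ 2 * x) := by gcongr
    _ = p ^ 5 * x := by ring

lemma add_self_pi_zmod_two {m : ℕ} (x : Fin m → ZMod 2) : x + x = 0 :=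
  funext fun i => CharTwo.add_self_eq_zero (x i)

lemma eq_of_add_eq_zero_pi_zmod_two {m : ℕ} {x y : Fin m → ZMod 2} (h : x + y = 0) : x = y :=
  funext fun i => CharTwo.add_eq_zero.1 (congrFun h i)

/-- If `v j ∉ N i + N i` for `j < i` and `A` and the image of `B` under `v` have few sums, then
some restricted neighbourhood `N i ∩ A`, or `B` itself, is bounded by a binomial tail. -/
lemma exists_smallSubsets_bound {n d : ℕ} {v : Fin n → Fin d → ZMod 2}
    (hv : Function.Injective v) {N : Fin n → Finset (Fin d → ZMod 2)}
    (hN : ∀ i, ∀ x ∈ N i, v i + x ∈ N i)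
    (hlt : ∀ i j, j < i → ∀ x ∈ N i, ∀ y ∈ N i, x + y ≠ v j)
    (A : Finset (Fin d → ZMod 2)) (hA : A.Nonempty) (B : Finset (Fin n)) (hB : B.Nonempty) :
    ∃ m : ℕ, 2 ^ m ≤ (A + A + (B.image v + B.image v)).card ∧
      (B.card ≤ (smallSubsets m (m / 3)).card ∨
        ∃ i ∈ B, (A.filter (· ∈ N i)).card ≤ 2 * (smallSubsets m (m / 3)).card) := by
  have memQ : ∀ x ∈ A, ∀ y ∈ A, ∀ i ∈ B, ∀ j ∈ B,
      x + y + (v i + v j) ∈ A + A + (B.image v + B.image v) := fun x hx y hy i hi j hj =>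
    Finset.add_mem_add (Finset.add_mem_add hx hy) (Finset.add_mem_add
      (Finset.mem_image_of_mem v hi) (Finset.mem_image_of_mem v hj))
  obtain ⟨a, ha⟩ := hA
  obtain ⟨b, hb⟩ := hB
  obtain ⟨m, φ, hm, hφ⟩ := exists_linearMap_ne_zero_on (A + A + (B.image v + B.image v))
    (by simpa [add_self_pi_zmod_two] using memQ a ha a ha b hb b hb)
  refine ⟨m, hm, ?_⟩
  by_contra! hcon
  obtain ⟨hcard, hdeg⟩ := hcon
  have hinj : Set.InjOn (fun i => φ (v i)) B := by
    intro i hi j hj hij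
    refine hv (eq_of_add_eq_zero_pi_zmod_two ?_)
    have h := hφ _ (memQ a ha a ha i hi j hj)
    rw [add_self_pi_zmod_two, zero_add, map_add] at h
    refine h ?_
    rw [show φ (v i) = φ (v j) from hij]
    exact add_self_pi_zmod_two _
  obtain ⟨c, hc, ⟨x₀, hx₀⟩, hsupp⟩ := exists_multilinear_supported (m := m) (k := m / 3) (by omega)
    (B.image fun i => φ (v i)) (by rwa [Finset.card_image_of_injOn hinj])
  have hne : (B.filter fun i => multilinearEval c (φ (v i)) ≠ 0).Nonempty := by
    by_contra! h
    apply hx₀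
    by_contra hx
    have hmem : x₀ ∈ B.image fun i => φ (v i) := by
      by_contra h'
      exact hx (hsupp _ h')
    obtain ⟨i, hi, rfl⟩ := Finset.mem_image.1 hmem
    exact (Finset.filter_eq_empty_iff.1 h hi) hx
  obtain ⟨i, hi, hmax⟩ := Finset.exists_max_image _ id hne
  simp only [Finset.mem_filter, id] at hi hmax
  refine (hdeg i hi.1).not_ge ?_
  have := card_le_of_multilinearEval_diagonal hc (ι := A.filter (· ∈ N i))
    (fun x => φ x.1) (fun x => φ (x.1 + v i)) ?_
  · rwa [Fintype.card_coe] at this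
  rintro ⟨x, hx⟩ ⟨y, hy⟩
  obtain ⟨hxA, hxN⟩ := Finset.mem_filter.1 hx
  obtain ⟨hyA, hyN⟩ := Finset.mem_filter.1 hy
  simp only [Subtype.mk.injEq]
  rw [← map_add]
  split_ifs with hxy
  · subst hxy
    rw [← add_assoc, add_self_pi_zmod_two, zero_add]
    exact (by decide : ∀ z : ZMod 2, z ≠ 0 → z = 1) _ hi.2
  · by_contra h
    have hmem : φ (x + (y + v i)) ∈ B.image fun i => φ (v i) := by
      by_contra h'
      exact h (hsupp _ h')
    obtain ⟨j, hj, hji⟩ := Finset.mem_image.1 hmem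
    have hji' : φ (v j) = φ (x + (y + v i)) := hji
    have hle := hmax j ⟨hj, by rwa [hji']⟩
    have hzero : x + y + (v i + v j) = 0 := by
      refine hφ _ (memQ x hxA y hyA i hi.1 j hj) ?_
      rw [← add_assoc, map_add φ _ (v j), add_assoc x, hji']
      exact add_self_pi_zmod_two _
    have hvj : x + (v i + y) = v j := by
      refine eq_of_add_eq_zero_pi_zmod_two ?_
      rw [← hzero]; abel
    rcases hle.lt_or_eq with hlt' | rfl
    · exact hlt i j hlt' x hxN _ (hN i y hyN) hvj
    · apply hxy
      refine eq_of_add_eq_zero_pi_zmod_two ?_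
      simpa [add_self_pi_zmod_two] using hzero

/-- A dense bipartite graph has large vertex subsets in which any two vertices from opposite sides
are joined by many paths of length three. -/
lemma exists_many_paths {α ι : Type*} [DecidableEq α] [Fintype ι] [DecidableEq ι]
    (V : Finset α) (N : ι → Finset α) (hNV : ∀ i, N i ⊆ V) {n δ : ℝ} (hn : 0 < n) (hδ : 0 < δ)
    (hι : (Fintype.card ι : ℝ) = n) (hV : (V.card : ℝ) ≤ n)
    (hT : ∑ i, ((N i).card : ℝ) = δ * n ^ 2) :
    ∃ A ⊆ V, ∃ B : Finset ι, δ * n / 6 ≤ A.card ∧ δ * n / 4 ≤ B.card ∧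
      (∀ i ∈ B, δ * A.card / 4 ≤ ((A.filter (· ∈ N i)).card : ℝ)) ∧
      ∀ x ∈ A, ∀ i ∈ B, δ ^ 5 * n ^ 2 / 12288 ≤
        (((V ×ˢ Finset.univ).filter fun p : α × ι => p.1 ∈ N i ∧ p.1 ∈ N p.2 ∧ x ∈ N p.2).card
          : ℝ) := by
  have double_count : ∀ {β : Type _} (W : Finset β) (r : β → ι → Prop) [∀ x i, Decidable (r x i)],
      ∑ i, ((W.filter (r · i)).card : ℝ) = ∑ x ∈ W, ((Finset.univ.filter (r x)).card : ℝ) := by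
    intro β W r _
    simp only [Finset.card_filter, Nat.cast_sum]
    exact Finset.sum_comm
  let deg : α → ℝ := fun x => ((Finset.univ.filter fun i => x ∈ N i).card : ℝ)
  let codeg : α → α → ℝ := fun x y => ((Finset.univ.filter fun i => x ∈ N i ∧ y ∈ N i).card : ℝ)
  let η : ℝ := δ ^ 3 * n / 256
  let V₀ := V.filter fun x => δ * n / 2 ≤ deg x
  let a : ι → ℝ := fun i => ((V₀.filter (· ∈ N i)).card : ℝ)
  have ha_sum : δ * n ^ 2 / 2 ≤ ∑ i, a i := by
    have h1 : δ * n ^ 2 = ∑ x ∈ V, deg x := by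
      rw [← hT, ← double_count V (fun x i => x ∈ N i)]
      refine Finset.sum_congr rfl fun i _ => ?_
      rw [Finset.filter_mem_eq_inter, Finset.inter_eq_right.2 (hNV i)]
    have h2 : ∑ i, a i = ∑ x ∈ V₀, deg x := double_count V₀ (fun x i => x ∈ N i)
    have h3 : ∑ x ∈ V with ¬ δ * n / 2 ≤ deg x, deg x ≤ n * (δ * n / 2) := by
      refine (Finset.sum_le_card_nsmul _ _ (δ * n / 2) fun x hx => ?_).trans ?_
      · exact (not_le.1 (Finset.mem_filter.1 hx).2).le
      · rw [nsmul_eq_mul]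
        gcongr
        exact (Nat.cast_le.2 (Finset.card_filter_le _ _)).trans hV
    rw [← Finset.sum_filter_add_sum_filter_not V (fun x => δ * n / 2 ≤ deg x)] at h1
    change δ * n ^ 2 = ∑ x ∈ V₀, deg x + _ at h1
    linarith
  have ha_sq : δ ^ 2 * n ^ 3 / 4 ≤ ∑ i, a i ^ 2 := by
    have h1 := sq_sum_le_card_mul_sum_sq (s := Finset.univ) (f := a)
    rw [Finset.card_univ, hι] at h1
    have h2 : (δ * n ^ 2 / 2) ^ 2 ≤ (∑ i, a i) ^ 2 := by gcongr
    refine le_of_mul_le_mul_left ?_ hn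
    linarith
  let bad := (V₀ ×ˢ V₀).filter fun p => codeg p.1 p.2 < η
  let b : ι → ℝ := fun i => ((bad.filter fun p => p.1 ∈ N i ∧ p.2 ∈ N i).card : ℝ)
  have hb_sum : ∑ i, b i ≤ η * n ^ 2 := by
    have h1 : ∑ i, b i = ∑ p ∈ bad, codeg p.1 p.2 :=
      double_count bad (fun p i => p.1 ∈ N i ∧ p.2 ∈ N i)
    rw [h1]
    refine (Finset.sum_le_card_nsmul _ _ η fun p hp => (Finset.mem_filter.1 hp).2.le).trans ?_
    have h2 : (bad.card : ℝ) ≤ n * n := by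
      have h3 : bad.card ≤ V.card * V.card := by
        refine (Finset.card_filter_le _ _).trans ?_
        rw [Finset.card_product]
        exact Nat.mul_le_mul (Finset.card_filter_le _ _) (Finset.card_filter_le _ _)
      calc (bad.card : ℝ) ≤ V.card * V.card := by exact_mod_cast h3
        _ ≤ n * n := by gcongr
    rw [nsmul_eq_mul, mul_comm, pow_two]
    gcongr
  have hι' : (Finset.univ : Finset ι).Nonempty := by
    rw [← Finset.card_pos, Finset.card_univ]
    exact_mod_cast hι ▸ hn
  obtain ⟨i₀, -, hi₀⟩ : ∃ i ∈ Finset.univ, δ ^ 2 * n ^ 2 / 8 ≤ a i ^ 2 - 32 / δ * b i := by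
    refine Finset.exists_le_of_sum_le hι' ?_
    rw [Finset.sum_const, Finset.card_univ, nsmul_eq_mul, hι, Finset.sum_sub_distrib,
      ← Finset.mul_sum]
    have h1 : 32 / δ * ∑ i, b i ≤ 32 / δ * (η * n ^ 2) := by gcongr
    have h2 : 32 / δ * (η * n ^ 2) = δ ^ 2 * n ^ 3 / 8 := by
      simp only [η]; field_simp; norm_num
    linarith
  let A₀ := V₀.filter (· ∈ N i₀)
  have hb0 : 0 ≤ b i₀ := Nat.cast_nonneg _
  have ha0 : 0 ≤ a i₀ := Nat.cast_nonneg _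
  have hδb : 0 ≤ 32 / δ * b i₀ := by positivity
  have ha_lower : δ * n / 3 ≤ a i₀ := by
    refine le_of_sq_le_sq ?_ ha0
    have : 0 ≤ δ ^ 2 * n ^ 2 := by positivity
    linarith
  have hb_upper : b i₀ ≤ δ * a i₀ ^ 2 / 32 := by
    have h1 : 32 / δ * b i₀ ≤ a i₀ ^ 2 := by
      have : 0 ≤ δ ^ 2 * n ^ 2 := by positivity
      linarith
    rw [div_mul_eq_mul_div, div_le_iff₀ hδ] at h1
    linarith
  have ha_pos : 0 < a i₀ := lt_of_lt_of_le (by positivity) ha_lower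
  let badDeg : α → ℝ := fun x => ((A₀.filter fun y => codeg x y < η).card : ℝ)
  have hbadDeg : ∑ x ∈ A₀, badDeg x = b i₀ := by
    have h1 : bad.filter (fun p => p.1 ∈ N i₀ ∧ p.2 ∈ N i₀) =
        (A₀ ×ˢ A₀).filter fun p => codeg p.1 p.2 < η := by
      ext p
      simp only [bad, A₀, Finset.mem_filter, Finset.mem_product]
      tauto
    simp only [b, badDeg]
    rw [h1]
    simp only [Finset.card_filter, Nat.cast_sum, Finset.sum_product]
  let A := A₀.filter fun x => badDeg x ≤ δ * a i₀ / 16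
  have hA_card : a i₀ / 2 ≤ A.card := by
    have h1 : ((A₀.filter fun x => ¬ badDeg x ≤ δ * a i₀ / 16).card : ℝ) * (δ * a i₀ / 16) ≤
        b i₀ := by
      rw [← hbadDeg, ← nsmul_eq_mul]
      refine (Finset.card_nsmul_le_sum _ badDeg _ fun x hx => ?_).trans
        (Finset.sum_le_sum_of_subset_of_nonneg (Finset.filter_subset _ _)
          fun _ _ _ => Nat.cast_nonneg _)
      exact (not_le.1 (Finset.mem_filter.1 hx).2).le
    have h2 : ((A₀.filter fun x => ¬ badDeg x ≤ δ * a i₀ / 16).card : ℝ) ≤ a i₀ / 2 := by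
      refine le_of_mul_le_mul_right (h1.trans (hb_upper.trans (le_of_eq ?_)))
        (show 0 < δ * a i₀ / 16 by positivity)
      ring
    have h3 : (A.card : ℝ) + (A₀.filter fun x => ¬ badDeg x ≤ δ * a i₀ / 16).card = A₀.card := by
      exact_mod_cast Finset.card_filter_add_card_filter_not (s := A₀)
        (fun x => badDeg x ≤ δ * a i₀ / 16)
    change _ = a i₀ at h3
    linarith
  have hA_pos : (0 : ℝ) < A.card := lt_of_lt_of_le (by positivity) hA_card
  have hAV₀ : A ⊆ V₀ := (Finset.filter_subset _ _).trans (Finset.filter_subset _ _)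
  have hAV : A ⊆ V := hAV₀.trans (Finset.filter_subset _ _)
  let B : Finset ι := {i | δ * A.card / 4 ≤ ((A.filter (· ∈ N i)).card : ℝ)}
  have hB_card : δ * n / 4 ≤ B.card := by
    have h1 : A.card * (δ * n / 2) ≤ ∑ i, ((A.filter (· ∈ N i)).card : ℝ) := by
      rw [double_count A (fun x i => x ∈ N i), ← nsmul_eq_mul]
      exact Finset.card_nsmul_le_sum _ _ _ fun x hx => (Finset.mem_filter.1 (hAV₀ hx)).2
    rw [← Finset.sum_filter_add_sum_filter_not Finset.univ
      (fun i => δ * A.card / 4 ≤ ((A.filter (· ∈ N i)).card : ℝ))] at h1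
    have h2 : ∑ i ∈ B, ((A.filter (· ∈ N i)).card : ℝ) ≤ B.card * A.card := by
      rw [← nsmul_eq_mul]
      exact Finset.sum_le_card_nsmul _ _ _ fun i _ => Nat.cast_le.2 (Finset.card_filter_le _ _)
    have h3 : ∑ i with ¬ δ * A.card / 4 ≤ ((A.filter (· ∈ N i)).card : ℝ),
        ((A.filter (· ∈ N i)).card : ℝ) ≤ n * (δ * A.card / 4) := by
      refine (Finset.sum_le_card_nsmul _ _ (δ * A.card / 4) fun i hi => ?_).trans ?_
      · exact (not_le.1 (Finset.mem_filter.1 hi).2).le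
      · rw [nsmul_eq_mul, ← hι]
        gcongr
        exact Finset.card_le_univ _
    change _ ≤ ∑ i ∈ B, ((A.filter (· ∈ N i)).card : ℝ) + _ at h1
    refine le_of_mul_le_mul_right ?_ hA_pos
    linarith
  refine ⟨A, hAV, B, by linarith, hB_card, fun i hi => (Finset.mem_filter.1 hi).2, ?_⟩
  intro x hx i hi
  let Y := (A.filter (· ∈ N i)).filter fun y => ¬ codeg x y < η
  have hY : δ * a i₀ / 16 ≤ Y.card := by
    have h1 : (((A.filter (· ∈ N i)).filter fun y => codeg x y < η).card : ℝ) + Y.card =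
        (A.filter (· ∈ N i)).card := by
      exact_mod_cast Finset.card_filter_add_card_filter_not (s := A.filter (· ∈ N i))
        (fun y => codeg x y < η)
    have h2 : (((A.filter (· ∈ N i)).filter fun y => codeg x y < η).card : ℝ) ≤ badDeg x := by
      refine Nat.cast_le.2 (Finset.card_le_card (Finset.filter_subset_filter _ ?_))
      exact (Finset.filter_subset _ _).trans (Finset.filter_subset _ _)
    have h3 := (Finset.mem_filter.1 hx).2
    have h4 := (Finset.mem_filter.1 hi).2
    have h5 : δ * (a i₀ / 2) ≤ δ * A.card := by gcongr
    linarith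
  have hpaths : (Y.card : ℝ) * η ≤
      (((V ×ˢ Finset.univ).filter fun p : α × ι =>
        p.1 ∈ N i ∧ p.1 ∈ N p.2 ∧ x ∈ N p.2).card : ℝ) := by
    have h1 : (Y.card : ℝ) * η ≤ ∑ y ∈ Y, codeg x y := by
      rw [← nsmul_eq_mul]
      exact Finset.card_nsmul_le_sum _ _ _ fun y hy => not_lt.1 (Finset.mem_filter.1 hy).2
    refine h1.trans ?_
    have h2 : ∑ y ∈ Y, codeg x y = ((Y.sigma fun y =>
        Finset.univ.filter fun k => x ∈ N k ∧ y ∈ N k).card : ℝ) := by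
      rw [Finset.card_sigma, Nat.cast_sum]
    rw [h2]
    refine Nat.cast_le.2 (Finset.card_le_card_of_injOn (fun p => (p.1, p.2)) ?_ ?_)
    · rintro ⟨y, k⟩ hp
      simp only [Finset.coe_sigma, Set.mem_sigma_iff, Finset.mem_coe, Finset.mem_filter,
        Finset.mem_univ, true_and, Y, Finset.mem_product, and_true] at hp ⊢
      exact ⟨hAV hp.1.1.1, hp.1.1.2, hp.2.2, hp.2.1⟩
    · rintro ⟨y, k⟩ - ⟨y', k'⟩ - h
      simp only [Prod.mk.injEq] at h
      rw [h.1, h.2]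
  refine le_trans ?_ hpaths
  calc δ ^ 5 * n ^ 2 / 12288 = (δ * (δ * n / 3) / 16) * (δ ^ 3 * n / 256) := by ring
    _ ≤ Y.card * η := by
      refine mul_le_mul (le_trans ?_ hY) le_rfl (by positivity) (by positivity)
      gcongr

/-- Each path of length three from `x` to `i` represents `x + v i` as a sum of three elements of
`V`. -/
lemma card_add_mul_le {n d : ℕ} {v : Fin n → Fin d → ZMod 2}
    (hv : Function.Injective v) {N : Fin n → Finset (Fin d → ZMod 2)}
    (hN : ∀ i, ∀ x ∈ N i, v i + x ∈ N i) (V : Finset (Fin d → ZMod 2)) (hNV : ∀ i, N i ⊆ V)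
    (A : Finset (Fin d → ZMod 2)) (B : Finset (Fin n)) (r : ℝ)
    (hr : ∀ x ∈ A, ∀ i ∈ B, r ≤ (((V ×ˢ Finset.univ).filter fun p : (Fin d → ZMod 2) × Fin n =>
      p.1 ∈ N i ∧ p.1 ∈ N p.2 ∧ x ∈ N p.2).card : ℝ)) :
    ((A + B.image v).card : ℝ) * r ≤ (V.card : ℝ) ^ 3 := by
  let f : (Fin d → ZMod 2) × (Fin d → ZMod 2) × (Fin d → ZMod 2) → Fin d → ZMod 2 :=
    fun p => p.1 + p.2.1 + p.2.2
  have hfib : ∀ z ∈ A + B.image v,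
      r ≤ (((V ×ˢ V ×ˢ V).filter fun p => f p = z).card : ℝ) := by
    intro z hz
    obtain ⟨x, hx, w, hw, rfl⟩ := Finset.mem_add.1 hz
    obtain ⟨i, hi, rfl⟩ := Finset.mem_image.1 hw
    refine (hr x hx i hi).trans (Nat.cast_le.2 (Finset.card_le_card_of_injOn
      (fun p => (v p.2 + x, v p.2 + p.1, v i + p.1)) ?_ ?_))
    · rintro ⟨y, k⟩ hp
      simp only [Finset.coe_filter, Finset.mem_product, Finset.mem_univ, and_true,
        Set.mem_ofPred_eq] at hp ⊢
      refine ⟨⟨hNV _ (hN _ _ hp.2.2.2), hNV _ (hN _ _ hp.2.2.1), hNV _ (hN _ _ hp.2.1)⟩, ?_⟩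
      calc v k + x + (v k + y) + (v i + y) = (v k + v k) + (y + y) + (x + v i) := by abel
        _ = x + v i := by
          rw [add_self_pi_zmod_two (v k), add_self_pi_zmod_two y, zero_add, zero_add]
    · rintro ⟨y, k⟩ - ⟨y', k'⟩ - h
      simp only [Prod.mk.injEq, add_left_inj, add_right_inj] at h
      rw [h.2.2, hv h.1]
  calc ((A + B.image v).card : ℝ) * r
      ≤ ∑ z ∈ A + B.image v, (((V ×ˢ V ×ˢ V).filter fun p => f p = z).card : ℝ) := by
        rw [← nsmul_eq_mul]
        exact Finset.card_nsmul_le_sum _ _ _ hfib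
    _ ≤ ((V ×ˢ V ×ˢ V).card : ℝ) := by
        rw [← Nat.cast_sum, Finset.sum_card_fiberwise_eq_card_filter]
        exact Nat.cast_le.2 (Finset.card_filter_le _ _)
    _ = (V.card : ℝ) ^ 3 := by
        rw [Finset.card_product, Finset.card_product]
        push_cast
        ring

lemma le_mul_rpow_of_pow_mul_pow_le {C δ n : ℝ} (hC : 1 ≤ C) (hδ : 0 ≤ δ) (hn : 1 ≤ n)
    (h : δ ^ 2494 * n ^ 7 ≤ C) : δ ≤ C * n ^ (-0.0028 : ℝ) := by
  have hn0 : 0 < n := by linarith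
  refine (pow_le_pow_iff_left₀ hδ (by positivity) (show 2494 ≠ 0 by norm_num)).1 ?_
  calc δ ^ 2494 ≤ C / n ^ 7 := by rwa [le_div_iff₀ (by positivity)]
    _ = C * n ^ (-7 : ℝ) := by
      rw [Real.rpow_neg hn0.le, div_eq_mul_inv]
      norm_cast
    _ ≤ C ^ 2494 * n ^ (-0.0028 * (2494 : ℕ) : ℝ) := by
      gcongr
      · exact le_self_pow₀ hC (by norm_num)
      · norm_num
    _ = (C * n ^ (-0.0028 : ℝ)) ^ 2494 := by
      rw [mul_pow, Real.rpow_mul_natCast hn0.le]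

lemma density_pow_le {K δ n Q t : ℝ} {m : ℕ} (hδ : 0 < δ) (hn : 0 < n)
    (hQ : 2 ^ m ≤ Q) (hQδ : Q * δ ^ 29 ≤ K * n) (ht : t ^ 3 ≤ (27 / 4) ^ m)
    (hδt : δ ^ 2 * n / 48 ≤ t) : δ ^ 2494 * n ^ 7 ≤ 48 ^ 87 * K ^ 80 := by
  have hQ0 : 0 < Q := lt_of_lt_of_le (by positivity) hQ
  have ht0 : 0 < t := lt_of_lt_of_le (by positivity) hδt
  have h1 : (δ ^ 2 * n / 48) ^ 87 ≤ Q ^ 80 := by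
    calc (δ ^ 2 * n / 48) ^ 87 ≤ t ^ 87 := by gcongr
      _ = (t ^ 3) ^ 29 := by rw [← pow_mul]
      _ ≤ ((27 / 4) ^ m) ^ 29 := by gcongr
      _ = ((27 / 4) ^ 29) ^ m := by rw [← pow_mul, ← pow_mul, mul_comm]
      _ ≤ (2 ^ 80) ^ m := by
        gcongr
        norm_num
      _ = (2 ^ m) ^ 80 := by rw [← pow_mul, ← pow_mul, mul_comm]
      _ ≤ Q ^ 80 := by gcongr
  rw [div_pow, div_le_iff₀ (by positivity)] at h1
  refine le_of_mul_le_mul_right ?_ (show 0 < n ^ 80 by positivity)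
  calc δ ^ 2494 * n ^ 7 * n ^ 80 = (δ ^ 2 * n) ^ 87 * δ ^ 2320 := by ring
    _ ≤ (Q ^ 80 * 48 ^ 87) * δ ^ 2320 := by gcongr
    _ = 48 ^ 87 * (Q * δ ^ 29) ^ 80 := by
      rw [mul_pow, ← pow_mul, mul_comm (Q ^ 80), mul_assoc]
    _ ≤ 48 ^ 87 * (K * n) ^ 80 := by gcongr
    _ = 48 ^ 87 * K ^ 80 * n ^ 80 := by rw [mul_pow, mul_assoc]

lemma sumset_bound {δ n a s p q K L : ℝ} (hδ : 0 < δ) (hn : 0 < n) (hK : K = 576 * L ^ 5)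
    (ha : δ * n / 6 ≤ a) (hs : δ * n / 4 ≤ s) (hp0 : 0 ≤ p) (hq0 : 0 ≤ q)
    (hp : p * δ ^ 5 ≤ L * n) (hq : q * (s ^ 2 * a ^ 2) ≤ p ^ 5) : q * δ ^ 29 ≤ K * n := by
  have h1 : q * ((δ * n / 4) ^ 2 * (δ * n / 6) ^ 2) ≤ p ^ 5 := by
    refine le_trans ?_ hq
    gcongr
  refine le_of_mul_le_mul_right ?_ (show 0 < n ^ 4 by positivity)
  calc q * δ ^ 29 * n ^ 4 = 576 * (q * ((δ * n / 4) ^ 2 * (δ * n / 6) ^ 2)) * δ ^ 25 := by ring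
    _ ≤ 576 * p ^ 5 * δ ^ 25 := by gcongr
    _ = 576 * (p * δ ^ 5) ^ 5 := by ring
    _ ≤ 576 * (L * n) ^ 5 := by gcongr
    _ = K * n * n ^ 4 := by rw [hK]; ring

/-- Additive-combinatorial form of the main bound, only using that `v j ∉ N i + N i` for `j < i`. -/
lemma sum_card_le {n d : ℕ} {v : Fin n → Fin d → ZMod 2}
    (hv : Function.Injective v) {N : Fin n → Finset (Fin d → ZMod 2)}
    (hNV : ∀ i, N i ⊆ Finset.univ.image v) (hN : ∀ i, ∀ x ∈ N i, v i + x ∈ N i)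
    (hlt : ∀ i j, j < i → ∀ x ∈ N i, ∀ y ∈ N i, x + y ≠ v j) {C K : ℝ}
    (hK : K = 576 * 12288 ^ 5) (hC : C = 48 ^ 87 * K ^ 80) (hC1 : 1 ≤ C) :
    (∑ i, ((N i).card : ℝ)) ≤ C * (n : ℝ) ^ ((2 : ℝ) - 0.0028) := by
  rcases (Finset.sum_nonneg fun i _ => Nat.cast_nonneg _ :
    (0 : ℝ) ≤ ∑ i, ((N i).card : ℝ)).eq_or_lt with h0 | hpos
  · rw [← h0]; positivity
  have hn1 : (1 : ℝ) ≤ n := by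
    rcases Nat.eq_zero_or_pos n with rfl | h
    · simp at hpos
    · exact_mod_cast h
  have hn : (0 : ℝ) < n := by linarith
  have hVcard : ((Finset.univ.image v).card : ℝ) = n := by
    rw [Finset.card_image_of_injective _ hv]; simp
  obtain ⟨δ, hδT⟩ : ∃ δ : ℝ, ∑ i, ((N i).card : ℝ) = δ * n ^ 2 :=
    ⟨(∑ i, ((N i).card : ℝ)) / n ^ 2, by field_simp⟩
  have hδ : 0 < δ := by
    rw [hδT] at hpos
    exact pos_of_mul_pos_left hpos (by positivity)
  have hδ1 : δ ≤ 1 := by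
    have h1 : ∑ i, ((N i).card : ℝ) ≤ n * n := by
      refine (Finset.sum_le_card_nsmul _ _ (n : ℝ) fun i _ => ?_).trans (by simp)
      rw [← hVcard]
      exact_mod_cast Finset.card_le_card (hNV i)
    refine le_of_mul_le_mul_right ?_ (show (0 : ℝ) < n ^ 2 by positivity)
    rw [← hδT]; linarith
  obtain ⟨A, -, B, hA, hB, hAB, hpath⟩ := exists_many_paths (Finset.univ.image v) N hNV hn hδ
    (by simp) hVcard.le hδT
  have hA0 : A.Nonempty := Finset.card_pos.1 (by
    exact_mod_cast (lt_of_lt_of_le (by positivity) hA : (0 : ℝ) < A.card))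
  have hB0 : B.Nonempty := Finset.card_pos.1 (by
    exact_mod_cast (lt_of_lt_of_le (by positivity) hB : (0 : ℝ) < B.card))
  have hP := card_add_mul_le hv hN _ hNV A B _ hpath
  rw [hVcard] at hP
  have hP' : ((A + B.image v).card : ℝ) * δ ^ 5 ≤ 12288 * n := by
    refine le_of_mul_le_mul_right ?_ (show (0 : ℝ) < n ^ 2 by positivity)
    linarith
  have hQ := card_add_add_add_le A (B.image v) hA0 (hB0.image v)
  rw [Finset.card_image_of_injective B hv] at hQ
  have hQδ := sumset_bound hδ hn hK hA hB (Nat.cast_nonneg _) (Nat.cast_nonneg _) hP' hQ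
  obtain ⟨m, hm, hm'⟩ := exists_smallSubsets_bound hv hN hlt A hA0 B hB0
  have ht : δ ^ 2 * n / 48 ≤ (smallSubsets m (m / 3)).card := by
    have hδn : δ ^ 2 * n ≤ δ * n := by
      gcongr
      exact pow_le_of_le_one hδ.le hδ1 two_ne_zero
    rcases hm' with h | ⟨i, hi, h⟩
    · have h' : (B.card : ℝ) ≤ (smallSubsets m (m / 3)).card := by exact_mod_cast h
      have : 0 < δ * n := by positivity
      linarith
    · have h' : ((A.filter (· ∈ N i)).card : ℝ) ≤ 2 * (smallSubsets m (m / 3)).card := by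
        exact_mod_cast h
      have h1 := hAB i hi
      have h2 : δ * (δ * n / 6) ≤ δ * A.card := by gcongr
      linarith
  have hmain := density_pow_le hδ hn (by exact_mod_cast hm) hQδ (card_smallSubsets_pow_le m) ht
  rw [← hC] at hmain
  have hfinal := le_mul_rpow_of_pow_mul_pow_le hC1 hδ.le hn1 hmain
  calc ∑ i, ((N i).card : ℝ) = δ * n ^ 2 := hδT
    _ ≤ C * (n : ℝ) ^ (-0.0028 : ℝ) * n ^ 2 := by gcongr
    _ = C * (n : ℝ) ^ ((2 : ℝ) - 0.0028) := by
      rw [mul_assoc, ← Real.rpow_natCast, ← Real.rpow_add hn]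
      congr 2
      norm_num

/-- Main additive-combinatorics theorem: there is a constant `C > 0` such that
for all `n, d`, all injective tuples `v : Fin n → 𝔽₂^d` with `V = {v 1, …, v n}`, and all
`N i ⊆ V` satisfying (i) `v i + N i = N i` and (ii) `v j ∉ span (N i + N i)` for `j < i`,
we have `∑ i, |N i| ≤ C * n ^ (2 - ε)` with `ε = 0.0028`. -/
theorem statement0 :
    ∃ C : ℝ, 0 < C ∧
      ∀ (n d : ℕ) (v : Fin n → (Fin d → ZMod 2)),
        Function.Injective v →
        ∀ N : Fin n → Finset (Fin d → ZMod 2),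
          (∀ i, N i ⊆ Finset.univ.image v) →
          (∀ i, (N i).image (fun w => v i + w) = N i) →
          (∀ i j : Fin n, j < i →
            v j ∉ Submodule.span (ZMod 2)
              (((N i + N i : Finset (Fin d → ZMod 2))) : Set (Fin d → ZMod 2))) →
          (∑ i, ((N i).card : ℝ)) ≤ C * (n : ℝ) ^ ((2 : ℝ) - 0.0028) := by
  obtain ⟨K, hK⟩ : ∃ K : ℝ, K = 576 * 12288 ^ 5 := ⟨_, rfl⟩
  obtain ⟨C, hC⟩ : ∃ C : ℝ, C = 48 ^ 87 * K ^ 80 := ⟨_, rfl⟩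
  have hC1 : 1 ≤ C := by
    rw [hC]
    refine one_le_mul_of_one_le_of_one_le (one_le_pow₀ (by norm_num)) (one_le_pow₀ ?_)
    rw [hK]
    norm_num
  refine ⟨C, by linarith, fun n d v hv N hNV hN hspan => sum_card_le hv hNV ?_ ?_ hK hC hC1⟩
  · intro i x hx
    have h := Finset.mem_image_of_mem (fun w => v i + w) hx
    rwa [hN i] at h
  · intro i j hij x hx y hy h
    refine hspan i j hij (Submodule.subset_span ?_)
    rw [← h]
    exact_mod_cast Finset.add_mem_add hx hy
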